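/- Let G : ℝ² → ℝ² be a homeomorphism of the plane that is isotopic to the identity, and suppose G has a periodic point, i.e., there exist x ∈ ℝ² and an integer t ≥ 1 with G^t(x) = x. Then G has a fixed point: there exists z ∈ ℝ² with G(z) = z. -/

import Mathlib

open Filter Topology

/-- `H : ℝ → X → X` (restricted to parameters in `[0,1]`) is an isotopy from `f` to `g`:
jointly continuous, each time-`t` map with `t ∈ [0,1]` a homeomorphism, `H 0 = f`,
`H 1 = g`. -/
def IsIsotopy {X : Type*} [TopologicalSpace X] (f g : X → X) (H : ℝ → X → X) : Prop :=
  Continuous (fun p : ℝ × X => H p.1 p.2) ∧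
  (∀ t ∈ Set.Icc (0 : ℝ) 1, IsHomeomorph (H t)) ∧
  H 0 = f ∧ H 1 = g

/-- `f` is isotopic to the identity. -/
def IsotopicToId {X : Type*} [TopologicalSpace X] (f : X → X) : Prop :=
  ∃ H : ℝ → X → X, IsIsotopy id f H

open Set

section Isotopy

variable {X : Type*} [TopologicalSpace X]

theorem IsotopicToId.comp {f g : X → X} (hf : IsotopicToId f) (hg : IsotopicToId g) :
    IsotopicToId (f ∘ g) := by
  obtain ⟨H, hHc, hHh, hH0, hH1⟩ := hf
  obtain ⟨K, hKc, hKh, hK0, hK1⟩ := hg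
  refine ⟨fun t ↦ H t ∘ K t, hHc.comp (continuous_fst.prodMk hKc),
    fun t ht ↦ (hHh t ht).comp (hKh t ht), ?_, ?_⟩
  · simp [hH0, hK0]
  · simp [hH1, hK1]

theorem IsotopicToId.conj {f : X → X} (hf : IsotopicToId f) (g : X ≃ₜ X) :
    IsotopicToId (g ∘ f ∘ g.symm) := by
  obtain ⟨H, hHc, hHh, hH0, hH1⟩ := hf
  refine ⟨fun t ↦ g ∘ H t ∘ g.symm, ?_,
    fun t ht ↦ g.isHomeomorph.comp ((hHh t ht).comp g.symm.isHomeomorph), ?_, ?_⟩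
  · exact g.continuous.comp (hHc.comp
      (continuous_fst.prodMk (g.symm.continuous.comp continuous_snd)))
  · ext z; simp [hH0]
  · simp [hH1]

/-- A map that is the identity off a set preserves that set as soon as it is injective. -/
theorem Function.Injective.mem_of_fixes_compl {α : Type*} {f : α → α}
    (hf : Function.Injective f) {U : Set α} (hU : ∀ z ∉ U, f z = z) {z : α} (hz : z ∈ U) :
    f z ∈ U := by
  by_contra h
  exact h (by rwa [hf (hU _ h)])

/-- A compact set disjoint from its image has an open neighborhood disjoint from its image, which
moreover misses a prescribed closed set. -/
theorem IsCompact.exists_isOpen_disjoint_image [T2Space X] (G : X ≃ₜ X) {C F : Set X}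
    (hC : IsCompact C) (hd : ∀ z ∈ C, G z ∉ C) (hF : IsClosed F) (hCF : ∀ z ∈ C, z ∉ F) :
    ∃ U, IsOpen U ∧ C ⊆ U ∧ (∀ z ∈ U, G z ∉ U) ∧ ∀ z ∈ U, z ∉ F := by
  have h : Disjoint C (G '' C) := by
    rw [disjoint_right]
    rintro _ ⟨z, hz, rfl⟩
    exact hd z hz
  obtain ⟨A, B, hA, hB, hCA, hCB, hAB⟩ :=
    SeparatedNhds.of_isCompact_isCompact hC (hC.image G.continuous) h
  refine ⟨A ∩ G ⁻¹' B ∩ Fᶜ, (hA.inter (hB.preimage G.continuous)).inter hF.isOpen_compl, ?_, ?_, ?_⟩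
  · exact fun z hz ↦ ⟨⟨hCA hz, hCB (mem_image_of_mem G hz)⟩, hCF z hz⟩
  · exact fun z hz hz' ↦ disjoint_left.1 hAB hz'.1.1 hz.1.2
  · exact fun z hz ↦ hz.2

end Isotopy

section Push

variable {E : Type*} [NormedAddCommGroup E] [NormedSpace ℝ E]

theorem isCompact_segment (a b : E) : IsCompact (segment ℝ a b) := by
  rw [segment_eq_image_lineMap]
  exact isCompact_Icc.image (by fun_prop)

variable [CompleteSpace E]

theorem LipschitzWith.isHomeomorph_id_add {h : E → E} {c : NNReal} (hh : LipschitzWith c h)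
    (hc : c < 1) : IsHomeomorph (fun z ↦ z + h z) := by
  have happ : ApproximatesLinearOn (fun z ↦ z + h z)
      ((ContinuousLinearEquiv.refl ℝ E : E ≃L[ℝ] E) : E →L[ℝ] E) univ c := by
    rw [ApproximatesLinearOn.approximatesLinearOn_iff_lipschitzOnWith]
    convert hh.lipschitzOnWith (s := univ) using 1
    ext z
    simp
  refine (happ.toHomeomorph _ ?_).isHomeomorph
  rcases subsingleton_or_nontrivial E with hE | hE
  · exact .inl hE
  · right
    have : ‖(((ContinuousLinearEquiv.refl ℝ E).symm : E ≃L[ℝ] E) : E →L[ℝ] E)‖₊ = 1 := by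
      ext
      simp
    rw [this, inv_one]
    exact hc

theorem exists_isotopicToId_of_ball_subset {U : Set E} {a b : E} {ε : ℝ}
    (hb : ‖b - a‖ < ε) (hU : Metric.ball a ε ⊆ U) :
    ∃ φ : E ≃ₜ E, IsotopicToId φ ∧ φ a = b ∧ ∀ z ∉ U, φ z = z := by
  have hε : 0 < ε := (norm_nonneg _).trans_lt hb
  set v : E := ε⁻¹ • (b - a) with hv
  have hv1 : ‖v‖ < 1 := by
    rw [hv, norm_smul, norm_inv, Real.norm_of_nonneg hε.le, inv_mul_lt_iff₀ hε]
    simpa using hb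
  set ρ : E → ℝ := fun z ↦ max (ε - ‖z - a‖) 0 with hρ
  have hρl : ∀ z w, |ρ z - ρ w| ≤ ‖z - w‖ := by
    intro z w
    refine (abs_max_sub_max_le_abs _ _ _).trans ?_
    have := abs_norm_sub_norm_le (w - a) (z - a)
    rw [sub_sub_sub_cancel_right, norm_sub_rev w z] at this
    simpa [sub_sub_sub_cancel_left] using this
  have hlip : ∀ t ∈ Icc (0 : ℝ) 1, LipschitzWith ‖v‖₊ (fun z ↦ (t * ρ z) • v) := by
    intro t ht
    refine LipschitzWith.of_dist_le_mul fun z w ↦ ?_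
    rw [dist_eq_norm, dist_eq_norm, ← sub_smul, norm_smul, ← mul_sub, norm_mul, coe_nnnorm,
      Real.norm_of_nonneg ht.1, mul_comm]
    refine mul_le_mul_of_nonneg_left ?_ (norm_nonneg _)
    calc t * ‖ρ z - ρ w‖ ≤ 1 * ‖z - w‖ :=
          mul_le_mul ht.2 (hρl z w) (norm_nonneg _) zero_le_one
      _ = ‖z - w‖ := one_mul _
  have hhom : ∀ t ∈ Icc (0 : ℝ) 1, IsHomeomorph (fun z ↦ z + (t * ρ z) • v) :=
    fun t ht ↦ (hlip t ht).isHomeomorph_id_add (by exact_mod_cast hv1)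
  have hρc : Continuous ρ := by fun_prop
  refine ⟨(hhom 1 (by simp)).homeomorph, ⟨fun t z ↦ z + (t * ρ z) • v, by fun_prop, hhom, ?_, ?_⟩,
    ?_, ?_⟩
  · ext z; simp
  · rfl
  · change a + (1 * ρ a) • v = b
    have : ρ a = ε := by simp [hρ, hε.le]
    rw [this, one_mul, hv, smul_inv_smul₀ hε.ne']
    abel
  · intro z hz
    change z + (1 * ρ z) • v = z
    have : ε ≤ ‖z - a‖ := by
      by_contra! h
      exact hz (hU (by rwa [mem_ball_iff_norm]))
    simp [hρ, this]

/-- Points of an open preconnected set can be pushed to each other by homeomorphisms supported in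
that set and isotopic to the identity. -/
theorem IsPreconnected.exists_isotopicToId {U : Set E} (hU : IsPreconnected U) (hUo : IsOpen U)
    {a b : E} (ha : a ∈ U) (hb : b ∈ U) :
    ∃ φ : E ≃ₜ E, IsotopicToId φ ∧ φ a = b ∧ ∀ z ∉ U, φ z = z := by
  refine hU.induction₂' (fun a b ↦ ∃ φ : E ≃ₜ E, IsotopicToId φ ∧ φ a = b ∧ ∀ z ∉ U, φ z = z)
    ?_ ?_ ha hb
  · intro x hx
    obtain ⟨ε, hε, hεU⟩ := Metric.isOpen_iff.1 hUo x hx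
    filter_upwards [mem_nhdsWithin_of_mem_nhds (Metric.ball_mem_nhds x (half_pos hε))] with y hy
    rw [mem_ball_iff_norm] at hy
    refine ⟨exists_isotopicToId_of_ball_subset (by linarith) hεU,
      exists_isotopicToId_of_ball_subset (ε := ε / 2) (by rwa [norm_sub_rev]) ?_⟩
    refine (Metric.ball_subset_ball' ?_).trans hεU
    rw [dist_eq_norm]
    linarith
  · rintro x y z - - - ⟨φ, hφ, hxy, hφU⟩ ⟨ψ, hψ, hyz, hψU⟩
    refine ⟨φ.trans ψ, hψ.comp hφ, by simp [hxy, hyz], fun w hw ↦ ?_⟩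
    simp [hφU w hw, hψU w hw]

theorem exists_isotopicToId_of_segment_subset {U : Set E} (hU : IsOpen U) {a b : E}
    (h : segment ℝ a b ⊆ U) :
    ∃ φ : E ≃ₜ E, IsotopicToId φ ∧ φ a = b ∧ ∀ z ∉ U, φ z = z := by
  obtain ⟨δ, hδ, hδU⟩ := (isCompact_segment a b).exists_thickening_subset_open hU h
  obtain ⟨φ, h1, h2, h3⟩ :=
    ((convex_segment a b).thickening δ).isPreconnected.exists_isotopicToId Metric.isOpen_thickening
      (Metric.self_subset_thickening hδ _ (left_mem_segment ℝ a b))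
      (Metric.self_subset_thickening hδ _ (right_mem_segment ℝ a b))
  exact ⟨φ, h1, h2, fun z hz ↦ h3 z fun hz' ↦ hz (hδU hz')⟩

end Push

section PeriodTwo

theorem Continuous.const_of_exp_comp_const {X : Type*} [TopologicalSpace X] [PreconnectedSpace X]
    {f : X → ℂ} (hf : Continuous f) (h : ∀ a b, Complex.exp (f a) = Complex.exp (f b)) (a b : X) :
    f a = f b :=
  Complex.isCoveringMap_exp.const_of_comp hf (fun a b ↦ Subtype.ext (h a b)) a b

/-- A fixed point free plane homeomorphism isotopic to the identity has no point of period two. -/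
theorem apply_apply_ne_of_isotopicToId {G : ℝ × ℝ → ℝ × ℝ} (hG : IsotopicToId G)
    (hfix : ∀ z, G z ≠ z) (p : ℝ × ℝ) : G (G p) ≠ p := by
  intro hp
  obtain ⟨H, hHc, hHh, hH0, hH1⟩ := hG
  have hGc : Continuous G := hH1 ▸ (hHh 1 (by simp)).continuous
  let e := Complex.equivRealProdCLM.symm
  let s : ℝ → ℝ := fun t ↦ projIcc 0 1 zero_le_one t
  have hs : Continuous s := by fun_prop
  have hs0 : s 0 = 0 := by simp [s]
  have hs1 : s 1 = 1 := by simp [s]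
  let F : ℝ × (ℝ × ℝ) → ℂ := fun q ↦ e (H (s q.1) (G q.2) - H (s q.1) q.2)
  have hFc : Continuous F := by
    refine e.continuous.comp (Continuous.sub ?_ ?_)
    · exact hHc.comp (f := fun q : ℝ × (ℝ × ℝ) ↦ (s q.1, G q.2)) (by fun_prop)
    · exact hHc.comp (f := fun q : ℝ × (ℝ × ℝ) ↦ (s q.1, q.2)) (by fun_prop)
  have hF0 : ∀ q, F q ≠ 0 := by
    intro q hq
    rw [map_eq_zero_iff e e.injective, sub_eq_zero] at hq
    exact hfix _ ((hHh (s q.1) (projIcc 0 1 zero_le_one q.1).2).injective hq)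
  have hsc : IsSimplyConnected (univ : Set (ℝ × (ℝ × ℝ))) :=
    (Homeomorph.Set.univ _).toHomotopyEquiv.simplyConnectedSpace
  obtain ⟨L, hLc, hL⟩ := Complex.exists_continuousOn_eqOn_exp_comp hsc isOpen_univ
    hFc.continuousOn (by simpa using hF0)
  rw [continuousOn_univ] at hLc
  have hL : ∀ q, Complex.exp (L q) = F q := fun q ↦ hL (mem_univ q)
  have hshift : ∀ z w, L (1, z) - L (0, G z) = L (1, w) - L (0, G w) := by
    refine Continuous.const_of_exp_comp_const (f := fun z ↦ L (1, z) - L (0, G z)) (by fun_prop) ?_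
    have : ∀ z, Complex.exp (L (1, z) - L (0, G z)) = 1 := by
      intro z
      have h : F (1, z) = F (0, G z) := by simp [F, hs0, hs1, hH0, hH1]
      rw [Complex.exp_sub, hL, hL, h, div_self (hF0 _)]
    intro a b
    rw [this, this]
  have hneg : ∀ t : ℝ, Complex.exp (L (t, p) - L (t, G p)) = -1 := by
    intro t
    have h : F (t, p) = -F (t, G p) := by
      simp only [F, hp, ← map_neg, neg_sub]
    rw [Complex.exp_sub, hL, hL, h, neg_div, div_self (hF0 _)]
  have hconst : L (0, p) - L (0, G p) = L (1, p) - L (1, G p) :=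
    Continuous.const_of_exp_comp_const (f := fun t : ℝ ↦ L (t, p) - L (t, G p)) (by fun_prop)
      (fun a b ↦ by rw [hneg, hneg]) 0 1
  have h1 := hshift p (G p)
  rw [hp] at h1
  have h0 : L (0, p) - L (0, G p) = 0 := by linear_combination (1 / 2) * hconst + (1 / 2) * h1
  have := hneg 0
  rw [h0, Complex.exp_zero] at this
  norm_num at this

end PeriodTwo

section Reduction

/-- No fixed point free homeomorphism of `E` isotopic to the identity has a point fixed by its
`n`-th iterate. -/
def NoPeriodicPoint (E : Type*) [TopologicalSpace E] (n : ℕ) : Prop :=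
  ∀ G : E ≃ₜ E, IsotopicToId G → (∀ z, G z ≠ z) → ∀ x, G^[n] x ≠ x

variable {E : Type*} [NormedAddCommGroup E] [NormedSpace ℝ E]

/-- If smaller periods are excluded, then a convex set disjoint from its image is disjoint from its
first iterates. -/
theorem Convex.iterate_notMem [CompleteSpace E] {n : ℕ}
    (hn : ∀ k, 1 ≤ k → k < n → NoPeriodicPoint E k)
    {G : E ≃ₜ E} (hG : IsotopicToId G) (hfix : ∀ z, G z ≠ z) {C : Set E} (hC : Convex ℝ C)
    (hd : ∀ z ∈ C, G z ∉ C) {k : ℕ} (hk : 1 ≤ k) (hkn : k < n) {p : E} (hp : p ∈ C) :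
    G^[k] p ∉ C := by
  induction k using Nat.strong_induction_on generalizing p with
  | _ k ih =>
  intro hq
  obtain ⟨m, rfl⟩ : ∃ m, k = m + 1 := ⟨k - 1, by omega⟩
  have hseg : segment ℝ (G^[m + 1] p) p ⊆ C := hC.segment_subset hq hp
  obtain ⟨U, hUo, hsU, hUd, hUF⟩ := (isCompact_segment (G^[m + 1] p) p).exists_isOpen_disjoint_image
    G (F := (fun j ↦ G^[j] p) '' Ioo 0 (m + 1)) (fun z hz hz' ↦ hd z (hseg hz) (hseg hz'))
    ((finite_Ioo _ _).image _).isClosed (by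
      rintro z hz ⟨j, hj, rfl⟩
      exact ih j hj.2 hj.1 (hj.2.trans hkn) hp (hseg hz))
  obtain ⟨φ, hφ, hφp, hφU⟩ := exists_isotopicToId_of_segment_subset hUo hsU
  have hiter : ∀ j ≤ m, (G.trans φ)^[j] p = G^[j] p := by
    intro j
    induction j with
    | zero => simp
    | succ j ihj =>
      intro hj
      rw [Function.iterate_succ_apply', ihj (by omega), Homeomorph.trans_apply,
        ← Function.iterate_succ_apply' (f := G)]
      exact hφU _ fun h ↦ hUF _ h ⟨j + 1, ⟨by omega, by omega⟩, rfl⟩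
  refine hn (m + 1) hk hkn (G.trans φ) (hφ.comp hG) (fun z hz ↦ ?_) p ?_
  · rw [Homeomorph.trans_apply] at hz
    by_cases h : G z ∈ U
    · have := φ.injective.mem_of_fixes_compl hφU h
      rw [hz] at this
      exact hUd z this h
    · exact hfix z (hφU _ h ▸ hz)
  · rw [Function.iterate_succ_apply', hiter m le_rfl, Homeomorph.trans_apply,
      ← Function.iterate_succ_apply' (f := G), hφp]

theorem convex_insert_ball {x y : E} {r : ℝ} (hr : 0 < r) (hy : y ∈ Metric.closedBall x r) :
    Convex ℝ (insert y (Metric.ball x r)) := by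
  have hb : Convex ℝ (Metric.ball x r) := convex_ball x r
  have hi : interior (Metric.ball x r) = Metric.ball x r := Metric.isOpen_ball.interior_eq
  rw [← closure_ball x hr.ne'] at hy
  rw [convex_iff_openSegment_subset]
  rintro a (rfl | ha) b (rfl | hb')
  · simp
  · rw [← hi] at hb'
    exact ((hb.openSegment_closure_interior_subset_interior hy hb').trans interior_subset).trans
      (subset_insert _ _)
  · rw [← hi] at ha
    exact ((hb.openSegment_interior_closure_subset_interior ha hy).trans interior_subset).trans
      (subset_insert _ _)
  · exact (hb.openSegment_subset ha hb').trans (subset_insert _ _)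

/-- A maximal ball disjoint from its image touches its image. -/
theorem exists_critical_ball [ProperSpace E] (G : E ≃ₜ E) {x : E} (hx : G x ≠ x) :
    ∃ (y : E) (r : ℝ), 0 < r ∧ y ∈ Metric.closedBall x r ∧ G y ∈ Metric.closedBall x r ∧
      y ∉ Metric.ball x r ∧ G y ∉ Metric.ball x r ∧
      ∀ z ∈ Metric.ball x r, G z ∉ Metric.ball x r := by
  let f : E → ℝ := fun z ↦ max (dist z x) (dist (G z) x)
  have hf : Continuous f := by fun_prop
  obtain ⟨y, hy⟩ := hf.exists_forall_le <| tendsto_atTop_mono (fun z ↦ le_max_left _ _)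
    (tendsto_dist_right_cocompact_atTop x)
  have hr : 0 < f y := by
    rcases eq_or_ne y x with h | h
    · exact lt_max_of_lt_right (by rw [h]; exact dist_pos.2 hx)
    · exact lt_max_of_lt_left (dist_pos.2 h)
  have hball : ∀ z ∈ Metric.ball x (f y), G z ∉ Metric.ball x (f y) := fun z hz hz' ↦
    (max_lt hz hz').not_ge (hy z)
  have hy1 : y ∈ Metric.closedBall x (f y) := Metric.mem_closedBall.2 (le_max_left _ _)
  have hy2 : G y ∈ Metric.closedBall x (f y) := Metric.mem_closedBall.2 (le_max_right _ _)
  refine ⟨y, f y, hr, hy1, hy2, fun h ↦ ?_, fun h ↦ ?_, hball⟩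
  · rw [← closure_ball x hr.ne'] at hy2
    obtain ⟨w, hw, hw'⟩ := mem_closure_iff.1 hy2 (G.symm ⁻¹' Metric.ball x (f y))
      (Metric.isOpen_ball.preimage G.symm.continuous) (by simpa using h)
    exact hball _ hw (by simpa using hw')
  · rw [← closure_ball x hr.ne'] at hy1
    obtain ⟨w, hw, hw'⟩ := mem_closure_iff.1 hy1 (G ⁻¹' Metric.ball x (f y))
      (Metric.isOpen_ball.preimage G.continuous) h
    exact hball _ hw' hw

/-- The period of a periodic point of a fixed point free homeomorphism can be lowered by one,
without creating fixed points, as long as it is at least three. -/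
theorem noPeriodicPoint_add_three [CompleteSpace E] [ProperSpace E] {m : ℕ}
    (hn : ∀ k, 1 ≤ k → k < m + 3 → NoPeriodicPoint E k) : NoPeriodicPoint E (m + 3) := by
  intro G hG hfix x hx
  obtain ⟨y, r, hr, hy, hGy, hy', hGy', hball⟩ := exists_critical_ball G (hfix x)
  have hGne : ∀ z ∈ Metric.ball x r, G z ≠ y := by
    rintro z hz rfl
    rw [← closure_ball x hr.ne'] at hy
    obtain ⟨w, hw, hw'⟩ := mem_closure_iff.1 hy (G.symm ⁻¹' Metric.ball x r)
      (Metric.isOpen_ball.preimage G.symm.continuous) (by simpa using hz)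
    exact hball _ hw (by simpa using hw')
  set C := insert y (Metric.ball x r)
  set C' := insert (G y) (Metric.ball x r)
  have hxb : x ∈ Metric.ball x r := Metric.mem_ball_self hr
  have hCd : ∀ z ∈ C, G z ∉ C := by
    rintro z (rfl | hz) (h | h)
    · exact hfix _ h
    · exact hGy' h
    · exact hGne z hz h
    · exact hball z hz h
  have hCn {k : ℕ} (hk : 1 ≤ k) (hkn : k < m + 3) {p : E} (hp : p ∈ C) : G^[k] p ∉ C :=
    (convex_insert_ball hr hy).iterate_notMem hn hG hfix hCd hk hkn hp
  have hC'd : ∀ z ∈ C', G z ∉ C' := by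
    rintro z (rfl | hz) (h | h)
    · exact hfix _ h
    · exact hCn (k := 2) (by omega) (by omega) (mem_insert y _) (mem_insert_of_mem _ h)
    · exact hy' (G.injective h ▸ hz)
    · exact hball z hz h
  have hC'n {k : ℕ} (hk : 1 ≤ k) (hkn : k < m + 3) {p : E} (hp : p ∈ C') : G^[k] p ∉ C' :=
    (convex_insert_ball hr hGy).iterate_notMem hn hG hfix hC'd hk hkn hp
  have hJ : segment ℝ y x ⊆ C :=
    (convex_insert_ball hr hy).segment_subset (mem_insert y _) (mem_insert_of_mem _ hxb)
  have hK : segment ℝ x (G y) ⊆ C' :=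
    (convex_insert_ball hr hGy).segment_subset (mem_insert_of_mem _ hxb) (mem_insert _ _)
  have hJK : ∀ z ∈ segment ℝ y x, G (G z) ∉ segment ℝ x (G y) := by
    intro z hz h
    rcases hK h with h | h
    · exact hCd z (hJ hz) (G.injective h ▸ mem_insert _ _)
    · exact hCn (k := 2) (by omega) (by omega) (hJ hz) (mem_insert_of_mem _ h)
  set J₂ := (G.trans G) '' segment ℝ y x
  have hJ₂c : IsCompact J₂ := (isCompact_segment y x).image (G.trans G).continuous
  set F := (fun j ↦ G^[j] x) '' Ioo 2 (m + 3)
  have hFc : IsClosed F := ((finite_Ioo _ _).image _).isClosed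
  obtain ⟨A, B, hA, hB, hKA, hJB, hAB⟩ := SeparatedNhds.of_isCompact_isCompact
    (isCompact_segment x (G y)) hJ₂c (disjoint_right.2 (by
      rintro _ ⟨z, hz, rfl⟩
      exact hJK z hz))
  obtain ⟨U, hUo, hKU, hUd, hUF⟩ := (isCompact_segment x (G y)).exists_isOpen_disjoint_image G
    (F := F ∪ Aᶜ) (fun z hz hz' ↦ hC'd z (hK hz) (hK hz')) (hFc.union hA.isClosed_compl) (by
      rintro z hz (⟨j, hj, rfl⟩ | h)
      · exact hC'n (k := j) (by have := hj.1; omega) hj.2 (mem_insert_of_mem _ hxb) (hK hz)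
      · exact h (hKA hz))
  obtain ⟨W, hWo, hJW, hWd, hWF⟩ := hJ₂c.exists_isOpen_disjoint_image G
    (F := F ∪ Bᶜ) (by
      rintro _ ⟨z, hz, rfl⟩ ⟨w, hw, h⟩
      have : w = G z := G.injective (G.injective h)
      exact hCd z (hJ hz) (hJ (this ▸ hw))) (hFc.union hB.isClosed_compl) (by
      rintro _ ⟨z, hz, rfl⟩ (⟨j, hj, h⟩ | h)
      · obtain ⟨i, rfl⟩ : ∃ i, j = i + 2 := ⟨j - 2, by have := hj.1; omega⟩
        have h' : G (G (G^[i] x)) = G (G z) := by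
          simpa only [Function.iterate_succ_apply', Homeomorph.trans_apply] using h
        have := G.injective (G.injective h')
        exact hCn (k := i) (by have := hj.1; omega) (by have := hj.2; omega)
          (mem_insert_of_mem _ hxb) (this ▸ hJ hz)
      · exact h (hJB (mem_image_of_mem _ hz)))
  have hUW : ∀ z ∈ U, z ∉ W := fun z hz hz' ↦ disjoint_left.1 hAB
    (by simpa using fun h ↦ hUF z hz (.inr h)) (by simpa using fun h ↦ hWF z hz' (.inr h))
  obtain ⟨φ, hφ, hφx, hφU⟩ := exists_isotopicToId_of_segment_subset hUo hKU
  obtain ⟨χ, hχ, hχy, hχW⟩ := exists_isotopicToId_of_segment_subset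
    (hWo.preimage (G.trans G).continuous) (image_subset_iff.1 hJW)
  let ψ : E ≃ₜ E := ((G.trans G).symm.trans χ).trans (G.trans G)
  have hψ : IsotopicToId ψ := hχ.conj (G.trans G)
  have hψW : ∀ z ∉ W, ψ z = z := by
    intro z hz
    have h : χ ((G.trans G).symm z) = (G.trans G).symm z := hχW _ (by simpa using hz)
    change (G.trans G) (χ ((G.trans G).symm z)) = z
    rw [h, Homeomorph.apply_symm_apply]
  have hψy : ψ (G (G y)) = G (G x) := by
    change (G.trans G) (χ ((G.trans G).symm ((G.trans G) y))) = _
    rw [Homeomorph.symm_apply_apply, hχy]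
    rfl
  have hGyU : G y ∈ U := hKU (right_mem_segment ℝ x (G y))
  have hGGyW : G (G y) ∈ W := hJW (mem_image_of_mem (G.trans G) (left_mem_segment ℝ y x))
  let G' : E ≃ₜ E := (G.trans φ).trans ψ
  have hG' : ∀ z, G' z = ψ (φ (G z)) := fun _ ↦ rfl
  have hiter : ∀ j ≤ m, G'^[j] (G (G x)) = G^[j + 2] x := by
    intro j
    induction j with
    | zero => simp
    | succ j ih =>
      intro hj
      have hmem : G^[j + 1 + 2] x ∈ F := ⟨j + 1 + 2, ⟨by omega, by omega⟩, rfl⟩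
      rw [Function.iterate_succ_apply', ih (by omega), hG',
        ← Function.iterate_succ_apply' (f := G), hφU _ fun h ↦ hUF _ h (.inl hmem),
        hψW _ fun h ↦ hWF _ h (.inl hmem)]
  refine hn (m + 2) (by omega) (by omega) G' (hψ.comp (hφ.comp hG)) (fun z hz ↦ ?_) (G (G x)) ?_
  · rw [hG'] at hz
    by_cases hU : G z ∈ U
    · have h := φ.injective.mem_of_fixes_compl hφU hU
      rw [hψW _ (hUW _ h)] at hz
      exact hUd z (hz ▸ h) hU
    · rw [hφU _ hU] at hz
      by_cases hW : G z ∈ W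
      · exact hWd z (hz ▸ ψ.injective.mem_of_fixes_compl hψW hW) hW
      · exact hfix z (hψW _ hW ▸ hz)
  · rw [Function.iterate_succ_apply', Function.iterate_succ_apply', hiter m le_rfl, hG' (G^[m + 2] x),
      ← Function.iterate_succ_apply' (f := G), hx, hφx, hψW _ (hUW _ hGyU), hG',
      hφU _ fun h ↦ hUW _ h hGGyW, hψy]

end Reduction

theorem noPeriodicPoint_plane {n : ℕ} (hn : 1 ≤ n) : NoPeriodicPoint (ℝ × ℝ) n := by
  induction n using Nat.strong_induction_on with
  | _ n ih =>
  match n, hn with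
  | 1, _ => exact fun G _ hfix x ↦ hfix x
  | 2, _ => exact fun G hG hfix x ↦ apply_apply_ne_of_isotopicToId hG hfix x
  | m + 3, _ => exact noPeriodicPoint_add_three fun k hk hkm ↦ ih k hkm hk

/-- A plane homeomorphism isotopic to the identity that has a periodic point has a fixed
point. -/
theorem fixed_point_of_periodic_point
    (G : ℝ × ℝ → ℝ × ℝ) (hG : IsHomeomorph G) (hGiso : IsotopicToId G)
    (x : ℝ × ℝ) (t : ℕ) (ht : 1 ≤ t) (hx : G^[t] x = x) :
    ∃ z : ℝ × ℝ, G z = z := by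
  by_contra! h
  exact noPeriodicPoint_plane ht hG.homeomorph hGiso h x hx
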